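/- arXiv:1703.10522 — 2 statements merged into one kernel-verified Lean document; each statement's English description precedes it below -/
import Mathlib

section
/- Let p be a pattern with reversal. If every variable occurring in the flattening p^♭ appears at least twice in p^♭, then p is avoidable. -/
/-!
Formalization framework: a variable alphabet `Σ` is a type `V`; the letter
`(x, false)` represents the variable `x` and `(x, true)` represents its mirror
image `x^R`.  A pattern with reversal is a `List (V × Bool)`, and a formula
with reversal is a set of such patterns (finiteness and nonemptiness of
fragments are taken as hypotheses where relevant).  A morphism respecting
reversal is determined by its values `h : V → List A` on plain variables.
-/

/-- The image of a pattern with reversal under the reversal-respecting extension of `h`. -/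
def applyRev {V A : Type*} (h : V → List A) (p : List (V × Bool)) : List A :=
  p.flatMap fun z => if z.2 then (h z.1).reverse else h z.1

/-- A morphism is non-erasing if it sends no variable to the empty word. -/
def NonErasing {V A : Type*} (h : V → List A) : Prop := ∀ x, h x ≠ []

/-- A formula with reversal `φ` occurs in a finite word `w`. -/
def OccursIn {V A : Type*} (φ : Set (List (V × Bool))) (w : List A) : Prop :=
  ∃ h : V → List A, NonErasing h ∧ ∀ p ∈ φ, applyRev h p <:+: w

/-- A formula with reversal is avoidable: over some finite alphabet,
infinitely many finite words avoid it. -/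
def FAvoidable {V : Type*} (φ : Set (List (V × Bool))) : Prop :=
  ∃ A : Type, Finite A ∧ {w : List A | ¬ OccursIn φ w}.Infinite

/-- The Zimin formulas with reversal `Z_{m,n}`, over the two-way variables
`Sum.inl i` (`i : Fin m`) and the one-way variables `Sum.inr j` (`j < n`):
`Z_{m,0} = x_1^♯ ⋯ x_m^♯` and `Z_{m,n} = Z_{m,n-1} y_n Z_{m,n-1}`. -/
def ZiminRev (m : ℕ) : ℕ → Set (List ((Fin m ⊕ ℕ) × Bool))
  | 0 => {p | ∃ b : Fin m → Bool, p = List.ofFn fun i => (Sum.inl i, b i)}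
  | n + 1 => {p | ∃ u ∈ ZiminRev m n, ∃ v ∈ ZiminRev m n,
      p = u ++ [(Sum.inr n, false)] ++ v}

/-- d-reversal: reverse a word over `Σ ∪ Σ^R` while swapping `x` with `x^R`. -/
def drev {V : Type*} (p : List (V × Bool)) : List (V × Bool) :=
  (p.map fun z => (z.1, !z.2)).reverse

/-- The image of a pattern with reversal under the d-reversal-respecting extension of `h`. -/
def applyDRev {V W : Type*} (h : V → List (W × Bool)) (p : List (V × Bool)) :
    List (W × Bool) :=
  p.flatMap fun z => if z.2 then drev (h z.1) else h z.1

/-- `φ` divides `ψ`: some non-erasing morphism respecting d-reversal sends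
every fragment of `φ` to a factor of a fragment of `ψ`. -/
def FDivides {V W : Type*} (φ : Set (List (V × Bool))) (ψ : Set (List (W × Bool))) : Prop :=
  ∃ h : V → List (W × Bool), NonErasing h ∧ ∀ p ∈ φ, ∃ q ∈ ψ, applyDRev h p <:+: q

/-- The letter `(x,b)` (i.e. `x` if `b = false`, `x^R` if `b = true`) appears in `φ`. -/
def Appears {V : Type*} (φ : Set (List (V × Bool))) (z : V × Bool) : Prop := ∃ p ∈ φ, z ∈ p

/-- `x` is a two-way variable of `φ`: both `x` and `x^R` appear in `φ`. -/
def TwoWay {V : Type*} (φ : Set (List (V × Bool))) (x : V) : Prop :=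
  Appears φ (x, false) ∧ Appears φ (x, true)

/-- `x` is a one-way variable of `φ`: exactly one of `x`, `x^R` appears in `φ`. -/
def OneWay {V : Type*} (φ : Set (List (V × Bool))) (x : V) : Prop :=
  (Appears φ (x, false) ∧ ¬ Appears φ (x, true)) ∨
  (Appears φ (x, true) ∧ ¬ Appears φ (x, false))

/-- The flattening of a pattern with reversal: forget all mirror images. -/
def flatten {V : Type*} (p : List (V × Bool)) : List V := p.map Prod.fst

/-- A finite word is a factor of an ω-word. -/
def InfFactor {A : Type*} (u : List A) (w : ℕ → A) : Prop :=
  ∃ i : ℕ, u = (List.range u.length).map fun j => w (i + j)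

/-- A formula with reversal occurs in an ω-word. -/
def OccursInInf {V A : Type*} (φ : Set (List (V × Bool))) (w : ℕ → A) : Prop :=
  ∃ h : V → List A, NonErasing h ∧ ∀ p ∈ φ, InfFactor (applyRev h p) w

/-- The image of a word (without reversal) under the extension of `h : Σ → A^*`. -/
def applyW {V A : Type*} (h : V → List A) (p : List V) : List A := p.flatMap h

/-- A formula without reversal occurs in a finite word. -/
def OccursInW {V A : Type*} (ψ : Set (List V)) (w : List A) : Prop :=
  ∃ h : V → List A, NonErasing h ∧ ∀ p ∈ ψ, applyW h p <:+: w

/-- A formula without reversal is avoidable. -/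
def WAvoidable {V : Type*} (ψ : Set (List V)) : Prop :=
  ∃ A : Type, Finite A ∧ {w : List A | ¬ OccursInW ψ w}.Infinite

section DoubledPatterns

open Finset

variable {V : Type*}

theorem applyRev_congr {A : Type*} {h g : V → List A} {p : List (V × Bool)}
    (hg : ∀ x ∈ flatten p, h x = g x) : applyRev h p = applyRev g p := by
  unfold applyRev
  refine List.flatMap_congr fun z hz => ?_
  rw [hg z.1 (List.mem_map_of_mem hz)]

theorem length_applyRev {A : Type*} [DecidableEq V] (h : V → List A) (p : List (V × Bool)) :
    (applyRev h p).length =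
      ∑ x ∈ (flatten p).toFinset, (flatten p).count x * (h x).length := by
  have key : (applyRev h p).length = ((flatten p).map fun x => (h x).length).sum := by
    induction p with
    | nil => rfl
    | cons z p ih =>
      have hz : applyRev h (z :: p) =
          (if z.2 then (h z.1).reverse else h z.1) ++ applyRev h p := rfl
      rw [hz, List.length_append, ih]
      simp only [flatten, List.map_cons, List.sum_cons]
      split_ifs <;> simp
  rw [key, Finset.sum_list_map_count]
  simp

theorem applyRev_ne_nil {A : Type*} {h : V → List A} {p : List (V × Bool)}
    (hh : NonErasing h) (hp : p ≠ []) : applyRev h p ≠ [] := by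
  obtain ⟨z, q, rfl⟩ := List.exists_cons_of_ne_nil hp
  intro hnil
  have hz := List.flatMap_eq_nil_iff.mp hnil z List.mem_cons_self
  have := hh z.1
  split_ifs at hz <;> simp_all

theorem OccursIn.mono {A : Type*} {φ : Set (List (V × Bool))} {v w : List A}
    (hv : OccursIn φ v) (hvw : v <:+: w) : OccursIn φ w := by
  obtain ⟨h, hne, hφ⟩ := hv
  exact ⟨h, hne, fun p hp => (hφ p hp).trans hvw⟩

/-- The words of length `n` over a finite alphabet. -/
noncomputable def wordsOfLength (A : Type*) [Finite A] (n : ℕ) : Finset (List A) :=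
  (List.finite_length_eq A n).toFinset

theorem mem_wordsOfLength {A : Type*} [Finite A] {n : ℕ} {w : List A} :
    w ∈ wordsOfLength A n ↔ w.length = n := by
  simp [wordsOfLength]

theorem card_wordsOfLength (A : Type*) [Fintype A] (n : ℕ) :
    #(wordsOfLength A n) = Fintype.card A ^ n := by
  rw [← card_vector n, ← Finset.card_univ]
  refine (Finset.card_bij (fun v _ => v.1) ?_ ?_ ?_).symm
  · exact fun v _ => mem_wordsOfLength.mpr v.2
  · exact fun v _ w _ hvw => Subtype.ext hvw
  · exact fun w hw => ⟨⟨w, mem_wordsOfLength.mp hw⟩, Finset.mem_univ _, rfl⟩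

open Classical in
/-- The words of length `n` that avoid the pattern `p`. -/
noncomputable def avoidingWords (A : Type*) [Finite A] (p : List (V × Bool)) (n : ℕ) :
    Finset (List A) :=
  {w ∈ wordsOfLength A n | ¬ OccursIn {p} w}

theorem mem_avoidingWords {A : Type*} [Finite A] {p : List (V × Bool)} {n : ℕ} {w : List A} :
    w ∈ avoidingWords A p n ↔ w.length = n ∧ ¬ OccursIn {p} w := by
  simp [avoidingWords, mem_wordsOfLength]

/-- The nonempty words of length at most `n`. -/
noncomputable def nonemptyWords (A : Type*) [Finite A] (n : ℕ) : Finset (List A) :=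
  (List.finite_length_le A n).toFinset.filter fun w => w.length ≠ 0

theorem mem_nonemptyWords {A : Type*} [Finite A] {n : ℕ} {w : List A} :
    w ∈ nonemptyWords A n ↔ w.length ≤ n ∧ w ≠ [] := by
  simp [nonemptyWords]

theorem sum_nonemptyWords (A : Type*) [Fintype A] (r : ℝ) (n : ℕ) :
    ∑ w ∈ nonemptyWords A n, r ^ w.length =
      ∑ i ∈ range n, (Fintype.card A * r) ^ (i + 1) := by
  classical
  have hU : nonemptyWords A n = (range n).biUnion fun i => wordsOfLength A (i + 1) := by
    ext w
    simp only [mem_nonemptyWords, mem_biUnion, mem_range, mem_wordsOfLength]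
    constructor
    · rintro ⟨hle, hne⟩
      have := List.length_pos_of_ne_nil hne
      exact ⟨w.length - 1, by omega, by omega⟩
    · rintro ⟨i, hi, hw⟩
      exact ⟨by omega, List.ne_nil_of_length_eq_add_one hw⟩
  rw [hU, sum_biUnion]
  · refine sum_congr rfl fun i _ => ?_
    rw [sum_congr rfl fun w hw => by rw [mem_wordsOfLength.mp hw], sum_const,
      card_wordsOfLength, nsmul_eq_mul, mul_pow]
    push_cast
    rfl
  · intro i _ j _ hij
    refine disjoint_left.mpr fun w hi hj => hij ?_
    have hi' := mem_wordsOfLength.mp hi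
    have hj' := mem_wordsOfLength.mp hj
    omega

theorem sum_nonemptyWords_le_one (n : ℕ) :
    ∑ w ∈ nonemptyWords (Fin 8) n, ((1 / 16 : ℝ)) ^ w.length ≤ 1 := by
  rw [sum_nonemptyWords]
  have hsum : ∀ m : ℕ, ∑ i ∈ range m, (1 / 2 : ℝ) ^ (i + 1) = 1 - (1 / 2) ^ m := by
    intro m
    induction m with
    | zero => simp
    | succ m ih => rw [sum_range_succ, ih]; ring
  have : ((Fintype.card (Fin 8) : ℕ) : ℝ) * (1 / 16) = 1 / 2 := by
    rw [Fintype.card_fin]; norm_num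
  rw [this, hsum]
  linarith [pow_nonneg (by norm_num : (0 : ℝ) ≤ 1 / 2) n]

open Classical in
/-- Extend a family of words indexed by a finite set of variables by the empty word. -/
noncomputable def extendByNil {A : Type*} {X : Finset V} (g : X → List A) (x : V) : List A :=
  if hx : x ∈ X then g ⟨x, hx⟩ else []

theorem extendByNil_coe {A : Type*} {X : Finset V} (g : X → List A) (x : X) :
    extendByNil g x = g x := by
  simp [extendByNil]

/-- A one-letter extension of an avoiding word either avoids the pattern or starts with one
of its instances. -/
theorem avoids_cons_or_starts_with_instance {A : Type*} {p : List (V × Bool)} {a : A} {w : List A}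
    (hw : ¬ OccursIn {p} w) :
    ¬ OccursIn {p} (a :: w) ∨ ∃ h : V → List A, NonErasing h ∧ applyRev h p <+: a :: w := by
  by_cases ho : OccursIn {p} (a :: w)
  · right
    obtain ⟨h, hne, hpre⟩ := ho
    refine ⟨h, hne, ?_⟩
    rcases List.infix_cons_iff.mp (hpre p rfl) with h1 | h1
    · exact h1
    · exact absurd ⟨h, hne, fun q hq => by rwa [Set.mem_singleton_iff.mp hq]⟩ hw
  · exact Or.inl ho

variable [DecidableEq V]

/-- Assignments of nonempty words to the variables of `p` for which the resulting instance of
`p` is nonempty of length at most `n`. -/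
noncomputable def boundedAssignments (A : Type*) [Finite A] (p : List (V × Bool)) (n : ℕ) :
    Finset ((flatten p).toFinset → List A) :=
  {g ∈ Fintype.piFinset fun _ => nonemptyWords A n |
    1 ≤ (applyRev (extendByNil g) p).length ∧ (applyRev (extendByNil g) p).length ≤ n}

theorem card_extensions_le {A : Type*} [Fintype A] (p : List (V × Bool)) (hp : p ≠ []) (n : ℕ) :
    Fintype.card A * #(avoidingWords A p n) ≤ #(avoidingWords A p (n + 1)) +
      ∑ g ∈ boundedAssignments A p (n + 1),
        #(avoidingWords A p (n + 1 - (applyRev (extendByNil g) p).length)) := by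
  classical
  set T : Finset (List A) :=
    (univ ×ˢ avoidingWords A p n).image fun z : A × List A => z.1 :: z.2 with hT
  have hTcard : #T = Fintype.card A * #(avoidingWords A p n) := by
    rw [hT, card_image_of_injective, card_product, card_univ]
    rintro ⟨a, v⟩ ⟨b, w⟩ hab
    simpa using hab
  rw [← hTcard]
  have hsub : T ⊆ avoidingWords A p (n + 1) ∪ (boundedAssignments A p (n + 1)).biUnion fun g =>
      (avoidingWords A p (n + 1 - (applyRev (extendByNil g) p).length)).image
        (applyRev (extendByNil g) p ++ ·) := by
    intro u hu
    obtain ⟨⟨a, w⟩, haw, rfl⟩ := mem_image.mp hu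
    obtain ⟨hlen, hav⟩ := mem_avoidingWords.mp (mem_product.mp haw).2
    rw [mem_union]
    rcases avoids_cons_or_starts_with_instance (a := a) hav with h1 | ⟨h, hne, v, hv⟩
    · exact Or.inl (mem_avoidingWords.mpr ⟨by simpa using hlen, h1⟩)
    right
    set g : (flatten p).toFinset → List A := fun x => h x with hg
    have hgh : applyRev (extendByNil g) p = applyRev h p :=
      applyRev_congr fun x hx => extendByNil_coe g ⟨x, List.mem_toFinset.mpr hx⟩
    have hpos := List.length_pos_of_ne_nil (applyRev_ne_nil hne hp)
    have hsum : (applyRev h p).length + v.length = n + 1 := by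
      have := congrArg List.length hv
      simp only [List.length_append, List.length_cons] at this hlen
      omega
    refine mem_biUnion.mpr ⟨g, ?_, ?_⟩
    · rw [boundedAssignments, mem_filter, hgh]
      refine ⟨Fintype.mem_piFinset.mpr fun x => mem_nonemptyWords.mpr ⟨?_, hne x⟩, by omega,
        by omega⟩
      have hle := single_le_sum (f := fun y => (flatten p).count y * (h y).length)
        (fun y _ => Nat.zero_le _) x.2
      rw [← length_applyRev] at hle
      have hcount : 0 < (flatten p).count (x : V) :=
        List.count_pos_iff.mpr (List.mem_toFinset.mp x.2)
      have := Nat.le_mul_of_pos_left (h x).length hcount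
      change (h x).length ≤ n + 1
      omega
    · rw [mem_image, hgh]
      refine ⟨v, mem_avoidingWords.mpr ⟨by omega, fun ho => hav (ho.mono ?_)⟩, hv⟩
      have hsuf : v <:+ a :: w := ⟨_, hv⟩
      rcases List.suffix_cons_iff.mp hsuf with h2 | h2
      · have := congrArg List.length h2
        simp only [List.length_cons] at this hlen
        omega
      · exact h2.isInfix
  refine (card_le_card hsub).trans ((card_union_le _ _).trans (Nat.add_le_add_left ?_ _))
  exact card_biUnion_le.trans (sum_le_sum fun g _ => card_image_le)

theorem pow_length_applyRev_le {A : Type*} {p : List (V × Bool)}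
    (h : ∀ x ∈ flatten p, 2 ≤ (flatten p).count x) (g : (flatten p).toFinset → List A) :
    (1 / 4 : ℝ) ^ (applyRev (extendByNil g) p).length ≤
      ∏ x, (1 / 16 : ℝ) ^ (g x).length := by
  have h16 : ∀ m : ℕ, (1 / 16 : ℝ) ^ m = (1 / 4) ^ (2 * m) := fun m => by
    rw [pow_mul]; norm_num
  simp_rw [h16]
  rw [prod_pow_eq_pow_sum]
  refine pow_le_pow_of_le_one (by norm_num) (by norm_num) ?_
  rw [length_applyRev, ← sum_coe_sort (flatten p).toFinset]
  refine sum_le_sum fun x _ => ?_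
  rw [extendByNil_coe]
  exact Nat.mul_le_mul_right _ (h x (List.mem_toFinset.mp x.2))

/-- Over eight letters the number of words avoiding a doubled pattern grows at least by a
factor of four with each additional letter. -/
theorem four_mul_card_avoidingWords_le {p : List (V × Bool)} (hp : p ≠ [])
    (h : ∀ x ∈ flatten p, 2 ≤ (flatten p).count x) (n : ℕ) :
    4 * (#(avoidingWords (Fin 8) p n) : ℝ) ≤ #(avoidingWords (Fin 8) p (n + 1)) := by
  induction n using Nat.strong_induction_on with
  | _ n ih =>
  set S : ℕ → ℝ := fun m => #(avoidingWords (Fin 8) p m) with hS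
  have hgrow : ∀ d ≤ n, S (n - d) ≤ S n * (1 / 4) ^ d := by
    intro d
    induction d with
    | zero => simp
    | succ d ihd =>
      intro hd
      have h1 : 4 * S (n - (d + 1)) ≤ S (n - (d + 1) + 1) := ih (n - (d + 1)) (by omega)
      rw [show n - (d + 1) + 1 = n - d by omega] at h1
      have h2 := ihd (by omega)
      rw [pow_succ]
      linarith
  have hcount := card_extensions_le (A := Fin 8) p hp n
  rw [Fintype.card_fin] at hcount
  have hcount' : 8 * S n ≤ S (n + 1) +
      ∑ g ∈ boundedAssignments (Fin 8) p (n + 1),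
        S (n + 1 - (applyRev (extendByNil g) p).length) := by
    simp only [hS]
    exact_mod_cast hcount
  have hS0 : 0 ≤ S n := Nat.cast_nonneg _
  have hbad : ∑ g ∈ boundedAssignments (Fin 8) p (n + 1),
        S (n + 1 - (applyRev (extendByNil g) p).length) ≤ 4 * S n := by
    calc _ ≤ ∑ g ∈ boundedAssignments (Fin 8) p (n + 1),
          4 * S n * ∏ x, (1 / 16 : ℝ) ^ (g x).length := by
          refine sum_le_sum fun g hg => ?_
          obtain ⟨h1, h2⟩ := (mem_filter.mp hg).2
          have h3 := pow_length_applyRev_le h g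
          obtain ⟨d, hd⟩ := Nat.exists_eq_add_of_le' h1
          rw [hd] at h2 h3 ⊢
          rw [Nat.add_sub_add_right]
          refine (hgrow d (by omega)).trans ?_
          rw [pow_succ] at h3
          have := mul_le_mul_of_nonneg_left h3 hS0
          linarith
      _ ≤ ∑ g ∈ Fintype.piFinset
          (fun _ : (flatten p).toFinset => nonemptyWords (Fin 8) (n + 1)),
          4 * S n * ∏ x, (1 / 16 : ℝ) ^ (g x).length :=
          sum_le_sum_of_subset_of_nonneg (filter_subset _ _) fun g _ _ => by positivity
      _ = 4 * S n * ∏ _x : (flatten p).toFinset,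
            ∑ w ∈ nonemptyWords (Fin 8) (n + 1), (1 / 16 : ℝ) ^ w.length := by
          rw [← mul_sum, prod_univ_sum]
      _ ≤ 4 * S n * 1 := by
          gcongr
          exact prod_le_one (fun _ _ => sum_nonneg fun _ _ => by positivity)
            fun _ _ => sum_nonemptyWords_le_one _
      _ = 4 * S n := mul_one _
  change 4 * S n ≤ S (n + 1)
  linarith

theorem avoidingWords_nonempty {p : List (V × Bool)} (hp : p ≠ [])
    (h : ∀ x ∈ flatten p, 2 ≤ (flatten p).count x) (n : ℕ) :
    (avoidingWords (Fin 8) p n).Nonempty := by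
  induction n with
  | zero =>
    refine ⟨[], mem_avoidingWords.mpr ⟨rfl, ?_⟩⟩
    rintro ⟨f, hf, hocc⟩
    exact applyRev_ne_nil hf hp (List.infix_nil.mp (hocc p rfl))
  | succ n ih =>
    have hpos : (0 : ℝ) < #(avoidingWords (Fin 8) p n) := by exact_mod_cast ih.card_pos
    have := four_mul_card_avoidingWords_le hp h n
    refine card_pos.mp ?_
    have h' : (0 : ℝ) < #(avoidingWords (Fin 8) p (n + 1)) := by linarith
    exact_mod_cast h'

end DoubledPatterns

/-- If every variable occurring in the flattening `p^♭` appears at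
least twice in `p^♭`, then the pattern with reversal `p` is avoidable. -/
theorem avoidable_of_all_vars_twice {V : Type*} [DecidableEq V]
    (p : List (V × Bool)) (hp : p ≠ [])
    (h : ∀ x ∈ flatten p, 2 ≤ (flatten p).count x) :
    FAvoidable {p} := by
  choose w hw using avoidingWords_nonempty hp h
  refine ⟨Fin 8, inferInstance, Set.infinite_of_injective_forall_mem (f := w) ?_
    fun n => (mem_avoidingWords.mp (hw n)).2⟩
  intro m n hmn
  rw [← (mem_avoidingWords.mp (hw m)).1, ← (mem_avoidingWords.mp (hw n)).1, hmn]
end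

section
/- Let k ≥ 3, let a_1, …, a_k be distinct letters, and let φ be a formula with reversal over Σ. If φ occurs in the periodic ω-word (a_1 a_2 ⋯ a_k)^ω through a non-erasing morphism h respecting reversal, then |h(x)| = 1 for every two-way variable x of φ, and consequently h(x^R) = h(x) for every two-way variable x of φ. -/
/-- Two consecutive letters of a factor of an ω-word are consecutive in the ω-word. -/
theorem InfFactor.exists_consecutive {A : Type*} {u : List A} {w : ℕ → A} (hu : InfFactor u w)
    {c d : A} (hcd : [c, d] <:+: u) : ∃ i, w i = c ∧ w (i + 1) = d := by
  obtain ⟨s, t, rfl⟩ := hcd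
  obtain ⟨i, hi⟩ := hu
  refine ⟨i + s.length, ?_, ?_⟩
  · have := congrArg (fun l => l[s.length]?) hi
    simpa [eq_comm] using this
  · have := congrArg (fun l => l[s.length + 1]?) hi
    simpa [eq_comm, add_assoc] using this

/-- The image of a letter of a pattern is a factor of the image of the pattern. -/
theorem isInfix_applyRev_of_mem {V A : Type*} (h : V → List A) {p : List (V × Bool)}
    {z : V × Bool} (hz : z ∈ p) :
    (if z.2 then (h z.1).reverse else h z.1) <:+: applyRev h p := by
  obtain ⟨s, t, rfl⟩ := List.append_of_mem hz
  exact ⟨applyRev h s, applyRev h t, by simp [applyRev]⟩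

/-- For `k ≥ 3`, no two residues modulo `k` are successors of each other. -/
theorem not_mod_succ_of_mod_succ {k i j : ℕ} (hk : 3 ≤ k) (hij : (i + 1) % k = j % k) :
    (j + 1) % k ≠ i % k := by
  intro hji
  have hmod : i + 2 ≡ i + 0 [MOD k] := (Nat.ModEq.add_right 1 hij).trans hji
  have hdvd : k ∣ 2 := (Nat.modEq_zero_iff_dvd).1 (Nat.ModEq.add_left_cancel' i hmod)
  exact absurd (Nat.le_of_dvd two_pos hdvd) (by omega)

/-- If `φ` occurs in the periodic ω-word `(a_1 a_2 ⋯ a_k)^ω`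
(`k ≥ 3`, the `a_i` distinct) through a non-erasing morphism `h` respecting
reversal, then `|h(x)| = 1` for every two-way variable `x` of `φ`, and consequently
`h(x^R) = h(x)` for every two-way variable `x` of `φ`. -/
theorem twoWay_image_single_letter {V A : Type*} (k : ℕ) (hk : 3 ≤ k)
    (a : Fin k → A) (hinj : Function.Injective a)
    (φ : Set (List (V × Bool))) (h : V → List A) (hne : NonErasing h)
    (hocc : ∀ p ∈ φ,
      InfFactor (applyRev h p) (fun i => a ⟨i % k, Nat.mod_lt i (by omega)⟩)) :
    ∀ x : V, TwoWay φ x → (h x).length = 1 ∧ (h x).reverse = h x := by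
  rintro x ⟨⟨p, hp, hxp⟩, ⟨q, hq, hxq⟩⟩
  have hinf := isInfix_applyRev_of_mem h hxp
  have hinfR := isInfix_applyRev_of_mem h hxq
  have hnil := hne x
  simp only [Bool.false_eq_true, if_false, if_true] at hinf hinfR
  match hx : h x with
  | [] => exact absurd hx hnil
  | [c] => simp
  | c :: d :: t =>
    rw [hx] at hinf hinfR
    have hcd : [c, d] <:+: c :: d :: t := ⟨[], t, rfl⟩
    have hdc : [d, c] <:+: (c :: d :: t).reverse := ⟨t.reverse, [], by simp⟩
    obtain ⟨i, hic, hid⟩ := (hocc p hp).exists_consecutive (hcd.trans hinf)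
    obtain ⟨j, hjd, hjc⟩ := (hocc q hq).exists_consecutive (hdc.trans hinfR)
    have hij := hinj (hid.trans hjd.symm)
    have hji := hinj (hjc.trans hic.symm)
    simp only [Fin.mk.injEq] at hij hji
    exact absurd hji (not_mod_succ_of_mod_succ hk hij)
end
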